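/- Let Q be a TC-query with timing sequence ε_1, …, ε_k, let σ be the edge with the largest timestamp in the current snapshot, and let i ∈ [2,k]. Then the map g ↦ g ∖ {σ} is an injection from the set of time-constrained matches of Preq(ε_i) in the snapshot that contain σ into the set Ω(Preq(ε_{i−1})) of time-constrained matches of Preq(ε_{i−1}) in the snapshot. In particular, the number of new matches of Preq(ε_i) created by the arrival of σ is at most |Ω(Preq(ε_{i−1}))|. (Cardinality core of Theorem 3: filtering an incoming edge costs time linear in the number of partial matches stored in the preceding item of the expansion list.) -/

import Mathlib

/-- A data edge of a streaming graph: two endpoints and a timestamp. -/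
structure DataEdge (V : Type*) where
  src : V
  dst : V
  time : ℝ

/-- The snapshot of a stream `S` at time `t` with window length `W`:
the edges whose timestamps lie in `(t - W, t]`. -/
def snapshot {V : Type*} (S : Set (DataEdge V)) (t W : ℝ) : Set (DataEdge V) :=
  {σ ∈ S | t - W < σ.time ∧ σ.time ≤ t}

/-- The endpoints of a set of directed edges. -/
def endpoints {ν : Type*} (E : Set (ν × ν)) : Set ν :=
  {u | ∃ v, (u, v) ∈ E ∨ (v, u) ∈ E}

/-- A query graph: vertices, directed edges, a vertex labelling and a strict
partial order (the timing order) on the edges. -/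
structure QueryGraph (ν Λ : Type*) where
  verts : Set ν
  edges : Set (ν × ν)
  edges_sub : ∀ e ∈ edges, e.1 ∈ verts ∧ e.2 ∈ verts
  label : ν → Λ
  prec : ν × ν → ν × ν → Prop
  prec_irrefl : ∀ e, ¬ prec e e
  prec_trans : ∀ a b c, prec a b → prec b c → prec a c

/-- The subquery induced by an edge set `E'`: its vertices are the endpoints of
`E'`, its edges are `E'`, with the restrictions of the labelling and of the
timing order. -/
def QueryGraph.induced {ν Λ : Type*} (Q : QueryGraph ν Λ) (E' : Set (ν × ν)) :
    QueryGraph ν Λ where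
  verts := endpoints E'
  edges := E'
  edges_sub := fun e he => ⟨⟨e.2, Or.inl he⟩, ⟨e.1, Or.inr he⟩⟩
  label := Q.label
  prec := fun a b => a ∈ E' ∧ b ∈ E' ∧ Q.prec a b
  prec_irrefl := fun e h => Q.prec_irrefl e h.2.2
  prec_trans := fun a b c h1 h2 => ⟨h1.1, h2.2.1, Q.prec_trans a b c h1.2.2 h2.2.2⟩

/-- A time-constrained match of the query `Q` in the snapshot `s` (over a data
vertex universe labelled by `label`): an injective assignment `F` of data
vertices to query vertices preserving labels, together with an assignment `h`
of snapshot edges to query edges having the prescribed endpoints, such that the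
timing order is reflected by the timestamps.  The matched subgraph is the image
`h '' Q.edges`, so that query edges correspond exactly (bijectively) to the
edges of the matched subgraph. -/
structure TCMatch {V ν Λ : Type*} (label : V → Λ) (Q : QueryGraph ν Λ)
    (s : Set (DataEdge V)) where
  F : ν → V
  h : ν × ν → DataEdge V
  F_inj : Set.InjOn F Q.verts
  label_eq : ∀ u ∈ Q.verts, label (F u) = Q.label u
  h_mem : ∀ e ∈ Q.edges, h e ∈ s
  h_src : ∀ e ∈ Q.edges, (h e).src = F e.1
  h_dst : ∀ e ∈ Q.edges, (h e).dst = F e.2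
  timing : ∀ e₁ ∈ Q.edges, ∀ e₂ ∈ Q.edges, Q.prec e₁ e₂ → (h e₁).time < (h e₂).time

/-- The prerequisite edge set of a query edge `e`:
`Preq(e) = {e' ∈ E(Q) : e' ≺ e} ∪ {e}`. -/
def Preq {ν Λ : Type*} (Q : QueryGraph ν Λ) (e : ν × ν) : Set (ν × ν) :=
  {e' ∈ Q.edges | Q.prec e' e} ∪ {e}

/-- `Ω(Q)`: the set of time-constrained matches (as subgraphs, i.e. edge sets)
of the query `Q` in the snapshot `s`. -/
def OmegaSet {V ν Λ : Type*} (label : V → Λ) (Q : QueryGraph ν Λ)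
    (s : Set (DataEdge V)) : Set (Set (DataEdge V)) :=
  {g | ∃ M : TCMatch label Q s, g = M.h '' Q.edges}

/-- Undirected adjacency via the edge set `E`. -/
def adjIn {ν : Type*} (E : Set (ν × ν)) (u v : ν) : Prop := (u, v) ∈ E ∨ (v, u) ∈ E

/-- An edge set is weakly connected if any two of its endpoints are joined by
a path of its edges, ignoring edge directions. -/
def WeaklyConnected {ν : Type*} (E : Set (ν × ν)) : Prop :=
  ∀ u ∈ endpoints E, ∀ v ∈ endpoints E, Relation.ReflTransGen (adjIn E) u v

/-- `ε : Fin k → ν × ν` is a timing sequence of `Q`: an enumeration of all the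
edges of `Q` each of whose prefixes induces a weakly connected subquery, with
`ε j ≺ ε (j+1)` for all `j`.  (`Q` is a TC-query iff it has a timing
sequence.) -/
def IsTimingSequence {ν Λ : Type*} (Q : QueryGraph ν Λ) (k : ℕ)
    (ε : Fin k → ν × ν) : Prop :=
  Function.Injective ε ∧ Set.range ε = Q.edges ∧
    (∀ j : Fin k, WeaklyConnected (ε '' {i | i ≤ j})) ∧
    (∀ i j : Fin k, (i : ℕ) + 1 = (j : ℕ) → Q.prec (ε i) (ε j))

/-- The edge `σ` of the stream `S` is discardable (w.r.t. `Q` and window `W`)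
if for every continuation of the stream by edges with timestamps greater than
`σ.time`, at no time `t' ≥ σ.time` does the snapshot contain a time-constrained
match of `Q` that includes `σ`. -/
def Discardable {V ν Λ : Type*} (label : V → Λ) (Q : QueryGraph ν Λ)
    (S : Set (DataEdge V)) (W : ℝ) (σ : DataEdge V) : Prop :=
  ∀ S' : Set (DataEdge V), S ⊆ S' → (∀ τ ∈ S' \ S, σ.time < τ.time) →
    ∀ t' ≥ σ.time, ∀ M : TCMatch label Q (snapshot S' t' W), σ ∉ M.h '' Q.edges

/-- Matches `M₁` of the subquery induced by `E₁` and `M₂` of the subquery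
induced by `E₂` are compatible if their vertex/edge assignments have a common
extension that is a time-constrained match of the subquery induced by
`E₁ ∪ E₂` (i.e. `F₁ ∪ F₂` is well-defined and `g₁ ∪ g₂` matches `Q¹ ∪ Q²`). -/
def Compatible {V ν Λ : Type*} (label : V → Λ) (Q : QueryGraph ν Λ)
    (E₁ E₂ : Set (ν × ν)) (s : Set (DataEdge V))
    (M₁ : TCMatch label (Q.induced E₁) s) (M₂ : TCMatch label (Q.induced E₂) s) :
    Prop :=
  ∃ M : TCMatch label (Q.induced (E₁ ∪ E₂)) s,
    (∀ u ∈ endpoints E₁, M.F u = M₁.F u) ∧ (∀ u ∈ endpoints E₂, M.F u = M₂.F u) ∧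
    (∀ e ∈ E₁, M.h e = M₁.h e) ∧ (∀ e ∈ E₂, M.h e = M₂.h e)

/-- The join `Ω(Q¹) ⋈ Ω(Q²)` of the match sets of the subqueries induced by
`E₁` and `E₂`: the unions `g₁ ∪ g₂` of compatible matches. -/
def OmegaJoin {V ν Λ : Type*} (label : V → Λ) (Q : QueryGraph ν Λ)
    (E₁ E₂ : Set (ν × ν)) (s : Set (DataEdge V)) : Set (Set (DataEdge V)) :=
  {g | ∃ M₁ : TCMatch label (Q.induced E₁) s, ∃ M₂ : TCMatch label (Q.induced E₂) s,
    Compatible label Q E₁ E₂ s M₁ M₂ ∧ g = M₁.h '' E₁ ∪ M₂.h '' E₂}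

/-- In a timing sequence, earlier edges precede later ones in the timing order. -/
theorem IsTimingSequence.prec_of_lt {ν Λ : Type*} {Q : QueryGraph ν Λ} {k : ℕ}
    {ε : Fin k → ν × ν} (hts : IsTimingSequence Q k ε) {a b : Fin k} (hab : a < b) :
    Q.prec (ε a) (ε b) := by
  obtain ⟨b, hb⟩ := b
  induction b with
  | zero => exact absurd hab (Nat.not_lt_zero _)
  | succ n ih =>
    have hstep : Q.prec (ε ⟨n, by omega⟩) (ε ⟨n + 1, hb⟩) := hts.2.2.2 _ _ rfl
    rcases Nat.lt_succ_iff_lt_or_eq.mp (Fin.lt_def.mp hab) with h | h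
    · exact Q.prec_trans _ _ _ (ih (by omega) (Fin.lt_def.mpr h)) hstep
    · rwa [show a = ⟨n, by omega⟩ from Fin.ext h]

/-- The prerequisite edge set of an edge of a timing sequence is the prefix ending there. -/
theorem IsTimingSequence.preq_eq {ν Λ : Type*} {Q : QueryGraph ν Λ} {k : ℕ}
    {ε : Fin k → ν × ν} (hts : IsTimingSequence Q k ε) (i : Fin k) :
    Preq Q (ε i) = ε '' Set.Iic i := by
  ext e
  constructor
  · rintro (⟨he, hp⟩ | rfl)
    · rw [← hts.2.1] at he
      obtain ⟨a, rfl⟩ := he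
      refine ⟨a, Set.mem_Iic.mpr <| le_of_not_gt fun h => ?_, rfl⟩
      exact Q.prec_irrefl _ (Q.prec_trans _ _ _ hp (hts.prec_of_lt h))
    · exact ⟨i, Set.self_mem_Iic, rfl⟩
  · rintro ⟨a, ha, rfl⟩
    rcases lt_or_eq_of_le (Set.mem_Iic.mp ha) with h | rfl
    · exact Or.inl ⟨hts.2.1 ▸ Set.mem_range_self a, hts.prec_of_lt h⟩
    · exact Or.inr rfl

/-- A match of an induced subquery restricts to any smaller edge set. -/
def TCMatch.restrict {V ν Λ : Type*} {label : V → Λ} {Q : QueryGraph ν Λ}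
    {s : Set (DataEdge V)} {E E' : Set (ν × ν)} (M : TCMatch label (Q.induced E) s)
    (hE : E' ⊆ E) : TCMatch label (Q.induced E') s :=
  have hverts : endpoints E' ⊆ endpoints E := fun _ ⟨v, hv⟩ => ⟨v, hv.imp (@hE _) (@hE _)⟩
  { F := M.F
    h := M.h
    F_inj := M.F_inj.mono hverts
    label_eq := fun u hu => M.label_eq u (hverts hu)
    h_mem := fun e he => M.h_mem e (hE he)
    h_src := fun e he => M.h_src e (hE he)
    h_dst := fun e he => M.h_dst e (hE he)
    timing := fun e₁ h₁ e₂ h₂ hp =>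
      M.timing e₁ (hE h₁) e₂ (hE h₂) ⟨hE h₁, hE h₂, hp.2.2⟩ }

/-- Removing an edge of largest timestamp from a match of `Preq (ε i)` leaves a match of
`Preq (ε j)`, where `j` is the position just before `i`. -/
theorem IsTimingSequence.diff_mem_omegaSet {V ν Λ : Type*} {label : V → Λ}
    {Q : QueryGraph ν Λ} {k : ℕ} {ε : Fin k → ν × ν} (hts : IsTimingSequence Q k ε)
    {s : Set (DataEdge V)} {σ : DataEdge V} (hmax : ∀ τ ∈ s, τ.time ≤ σ.time)
    {i j : Fin k} (hij : (j : ℕ) + 1 = i) {g : Set (DataEdge V)}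
    (hg : g ∈ OmegaSet label (Q.induced (Preq Q (ε i))) s) (hσ : σ ∈ g) :
    g \ {σ} ∈ OmegaSet label (Q.induced (Preq Q (ε j))) s := by
  obtain ⟨M, rfl⟩ := hg
  have mem {a : Fin k} (ha : a ≤ i) : ε a ∈ Preq Q (ε i) :=
    hts.preq_eq i ▸ Set.mem_image_of_mem ε ha
  have time_lt {a : Fin k} (ha : a < i) : (M.h (ε a)).time < (M.h (ε i)).time :=
    M.timing _ (mem ha.le) _ (mem le_rfl) ⟨mem ha.le, mem le_rfl, hts.prec_of_lt ha⟩
  have hσi : M.h (ε i) = σ := by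
    obtain ⟨e, he, rfl⟩ := hσ
    obtain ⟨a, ha, rfl⟩ := (hts.preq_eq i).subset he
    rcases lt_or_eq_of_le (Set.mem_Iic.mp ha) with h | rfl
    · exact absurd (hmax _ (M.h_mem _ (mem le_rfl))) (time_lt h).not_ge
    · rfl
  have hsub : Preq Q (ε j) ⊆ Preq Q (ε i) := by
    rw [hts.preq_eq, hts.preq_eq]
    exact Set.image_mono (Set.Iic_subset_Iic.mpr (Fin.le_def.mpr (by omega)))
  refine ⟨M.restrict hsub, ?_⟩
  change M.h '' Preq Q (ε i) \ {σ} = M.h '' Preq Q (ε j)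
  apply Set.Subset.antisymm
  · rintro _ ⟨⟨e, he, rfl⟩, hne⟩
    obtain ⟨a, ha, rfl⟩ := (hts.preq_eq i).subset he
    have hai : a ≠ i := by
      rintro rfl
      exact hne hσi
    have haj : a ≤ j := by
      have := Fin.lt_def.mp (lt_of_le_of_ne (Set.mem_Iic.mp ha) hai)
      exact Fin.le_def.mpr (by omega)
    exact ⟨ε a, hts.preq_eq j ▸ Set.mem_image_of_mem ε haj, rfl⟩
  · rintro _ ⟨e, he, rfl⟩
    refine ⟨Set.mem_image_of_mem _ (hsub he), fun heq => ?_⟩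
    obtain ⟨a, ha, rfl⟩ := (hts.preq_eq j).subset he
    have hai : a < i := by
      have := Fin.le_def.mp (Set.mem_Iic.mp ha)
      exact Fin.lt_def.mpr (by omega)
    exact (time_lt hai).ne (congrArg DataEdge.time (heq.trans hσi.symm))

/-- **Cardinality core of Theorem 3.**  Let `Q` be a TC-query with timing
sequence `ε 0, …, ε (k-1)`, let `σ` be the edge with the largest timestamp in
the current snapshot `s`, and let `i ≥ 1` (the `(i+1)`-st edge of the
sequence, i.e. position in `[2,k]` in 1-based numbering).  Then `g ↦ g \ {σ}`
maps the set of time-constrained matches of `Preq (ε i)` in `s` that contain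
`σ` injectively into `Ω(Preq (ε (i-1)))`; in particular the number of new
matches of `Preq (ε i)` created by the arrival of `σ` is at most
`|Ω(Preq (ε (i-1)))|`. -/
theorem new_matches_inject_into_previous_item {V ν Λ : Type*} (label : V → Λ)
    (Q : QueryGraph ν Λ) (k : ℕ) (ε : Fin k → ν × ν)
    (hts : IsTimingSequence Q k ε)
    (s : Set (DataEdge V)) (σ : DataEdge V) (hσ : σ ∈ s)
    (hmax : ∀ τ ∈ s, τ.time ≤ σ.time)
    (i : Fin k) (hi : 1 ≤ (i : ℕ)) :
    Set.MapsTo (fun g => g \ {σ})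
      {g | g ∈ OmegaSet label (Q.induced (Preq Q (ε i))) s ∧ σ ∈ g}
      (OmegaSet label (Q.induced (Preq Q (ε ⟨(i : ℕ) - 1,
        Nat.lt_of_le_of_lt (Nat.sub_le _ _) i.isLt⟩))) s) ∧
    Set.InjOn (fun g => g \ {σ})
      {g | g ∈ OmegaSet label (Q.induced (Preq Q (ε i))) s ∧ σ ∈ g} ∧
    Cardinal.mk
      ↥{g | g ∈ OmegaSet label (Q.induced (Preq Q (ε i))) s ∧ σ ∈ g} ≤
      Cardinal.mk ↥(OmegaSet label (Q.induced (Preq Q (ε ⟨(i : ℕ) - 1,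
        Nat.lt_of_le_of_lt (Nat.sub_le _ _) i.isLt⟩))) s) := by
  have hmaps : Set.MapsTo (fun g => g \ {σ})
      {g | g ∈ OmegaSet label (Q.induced (Preq Q (ε i))) s ∧ σ ∈ g}
      (OmegaSet label (Q.induced (Preq Q (ε ⟨(i : ℕ) - 1,
        Nat.lt_of_le_of_lt (Nat.sub_le _ _) i.isLt⟩))) s) := fun _ hg =>
    hts.diff_mem_omegaSet hmax (Nat.sub_add_cancel hi) hg.1 hg.2
  have hinj : Set.InjOn (fun g => g \ {σ})
      {g | g ∈ OmegaSet label (Q.induced (Preq Q (ε i))) s ∧ σ ∈ g} := by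
    intro g hg g' hg' h
    rw [← Set.insert_sdiff_self_of_mem hg.2, ← Set.insert_sdiff_self_of_mem hg'.2]
    exact congrArg (insert σ) h
  exact ⟨hmaps, hinj, Cardinal.mk_le_of_injective (hmaps.restrict_inj.mpr hinj)⟩
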